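/- arXiv:2502.18103 — 7 statements merged into one kernel-verified Lean document; each statement's English description precedes it below -/
import Mathlib

section
/- For every real a > 0, the map φ_a is a homeomorphism from the model simplex Ω_n onto the outward cuspidal domain Ω_γ, and its inverse is given by ψ_a(x) = (x_1 x_n^{1/a−σ}, …, x_{n−1} x_n^{1/a−σ}, x_n^{1/a}) for x ∈ Ω_γ. -/
open MeasureTheory Real Filter Topology
open scoped ENNReal

noncomputable section

/-- The last coordinate `x_n` of a point in `ℝ^n` (junk value `0` if `n = 0`). -/
def lastCoord {n : ℕ} (x : EuclideanSpace ℝ (Fin n)) : ℝ :=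
  if h : 0 < n then x ⟨n - 1, Nat.sub_lt h Nat.one_pos⟩ else 0

/-- The outward cuspidal domain
`Ω_γ = {x : 0 < x_n < 1, 0 < x_i < x_n ^ σ for i = 1, …, n-1}` (with `σ = (γ-1)/(n-1)`). -/
def cuspDomain (n : ℕ) (σ : ℝ) : Set (EuclideanSpace ℝ (Fin n)) :=
  {x | 0 < lastCoord x ∧ lastCoord x < 1 ∧
    ∀ i : Fin n, (i : ℕ) + 1 ≠ n → 0 < x i ∧ x i < lastCoord x ^ σ}

/-- The model simplex `Ω_n = {y : 0 < y_n < 1, 0 < y_i < y_n for i = 1, …, n-1}`. -/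
def simplexDomain (n : ℕ) : Set (EuclideanSpace ℝ (Fin n)) := cuspDomain n 1

/-- The map `φ_a(y) = (y_1 y_n^{aσ-1}, …, y_{n-1} y_n^{aσ-1}, y_n^a)`. -/
def phiMap (n : ℕ) (σ a : ℝ) (y : EuclideanSpace ℝ (Fin n)) : EuclideanSpace ℝ (Fin n) :=
  WithLp.toLp 2 fun i => if (i : ℕ) + 1 = n then lastCoord y ^ a else y i * lastCoord y ^ (a * σ - 1)

/-- The map `ψ_a(x) = (x_1 x_n^{1/a-σ}, …, x_{n-1} x_n^{1/a-σ}, x_n^{1/a})`. -/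
def psiMap (n : ℕ) (σ a : ℝ) (x : EuclideanSpace ℝ (Fin n)) : EuclideanSpace ℝ (Fin n) :=
  WithLp.toLp 2 fun i => if (i : ℕ) + 1 = n then lastCoord x ^ (1 / a) else x i * lastCoord x ^ (1 / a - σ)

/-- The weight `w_{γ,a}(x) = (1/a) x_n^{n/a - γ}`. -/
def weightA (n : ℕ) (γ a : ℝ) (x : EuclideanSpace ℝ (Fin n)) : ℝ :=
  (1 / a) * lastCoord x ^ ((n : ℝ) / a - γ)

/-- The weight `w_γ(x) = ((γ-p)/(n-p)) x_n^{p(γ-n)/(n-p)}`. -/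
def weightG (n : ℕ) (γ p : ℝ) (x : EuclideanSpace ℝ (Fin n)) : ℝ :=
  ((γ - p) / ((n : ℝ) - p)) * lastCoord x ^ (p * (γ - (n : ℝ)) / ((n : ℝ) - p))

def genMap (n : ℕ) (p q : ℝ) (y : EuclideanSpace ℝ (Fin n)) : EuclideanSpace ℝ (Fin n) :=
  WithLp.toLp 2 fun i => if (i : ℕ) + 1 = n then lastCoord y ^ p else y i * lastCoord y ^ q

lemma lastCoord_genMap {n : ℕ} (hn : 2 ≤ n) (p q : ℝ) (y : EuclideanSpace ℝ (Fin n)) :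
    lastCoord (genMap n p q y) = lastCoord y ^ p := by
  have h0 : 0 < n := by omega
  have h1 : n - 1 + 1 = n := by omega
  rw [lastCoord, dif_pos h0]
  simp [genMap, h1]

lemma lastCoord_eq {n : ℕ} (y : EuclideanSpace ℝ (Fin n)) (i : Fin n) (hi : (i : ℕ) + 1 = n) :
    lastCoord y = y i := by
  have h0 : 0 < n := by omega
  rw [lastCoord, dif_pos h0]
  have e : (⟨n - 1, Nat.sub_lt h0 Nat.one_pos⟩ : Fin n) = i := Fin.ext (by simp; omega)
  rw [e]

lemma genMap_mem {n : ℕ} (hn : 2 ≤ n) {p q s s' : ℝ} (hp : 0 < p) (h : s + q = p * s')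
    {y : EuclideanSpace ℝ (Fin n)} (hy : y ∈ cuspDomain n s) :
    genMap n p q y ∈ cuspDomain n s' := by
  obtain ⟨h0, h1, h2⟩ := hy
  refine ⟨?_, ?_, ?_⟩
  · rw [lastCoord_genMap hn]; exact Real.rpow_pos_of_pos h0 _
  · rw [lastCoord_genMap hn]; exact Real.rpow_lt_one h0.le h1 hp
  · intro i hi
    obtain ⟨h3, h4⟩ := h2 i hi
    have hq := Real.rpow_pos_of_pos h0 q
    rw [lastCoord_genMap hn, ← Real.rpow_mul h0.le, ← h, Real.rpow_add h0]
    have e : genMap n p q y i = y i * lastCoord y ^ q := by simp [genMap, hi]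
    rw [e]
    exact ⟨mul_pos h3 hq, mul_lt_mul_of_pos_right h4 hq⟩

lemma genMap_inv {n : ℕ} (hn : 2 ≤ n) {p q p' q' s : ℝ} (hp : p * p' = 1) (hq : q + p * q' = 0)
    {y : EuclideanSpace ℝ (Fin n)} (hy : y ∈ cuspDomain n s) :
    genMap n p' q' (genMap n p q y) = y := by
  have h0 := hy.1
  ext i
  by_cases hi : (i : ℕ) + 1 = n
  · have e : genMap n p' q' (genMap n p q y) i = lastCoord (genMap n p q y) ^ p' := by
      simp [genMap, hi]
    rw [e, lastCoord_genMap hn, ← Real.rpow_mul h0.le, hp, Real.rpow_one, lastCoord_eq y i hi]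
  · have e : genMap n p' q' (genMap n p q y) i
        = genMap n p q y i * lastCoord (genMap n p q y) ^ q' := by
      simp [genMap, hi]
    have e' : genMap n p q y i = y i * lastCoord y ^ q := by simp [genMap, hi]
    rw [e, e', lastCoord_genMap hn, ← Real.rpow_mul h0.le, mul_assoc, ← Real.rpow_add h0, hq,
      Real.rpow_zero, mul_one]

lemma continuous_lastCoord {n : ℕ} :
    Continuous (lastCoord : EuclideanSpace ℝ (Fin n) → ℝ) := by
  unfold lastCoord
  split_ifs <;> fun_prop

lemma genMap_cont {n : ℕ} (p q s : ℝ) :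
    Continuous (fun y : cuspDomain n s => genMap n p q y) := by
  have hl : Continuous (fun y : cuspDomain n s => lastCoord (y : EuclideanSpace ℝ (Fin n))) :=
    continuous_lastCoord.comp continuous_subtype_val
  have hr : ∀ r : ℝ, Continuous
      (fun y : cuspDomain n s => lastCoord (y : EuclideanSpace ℝ (Fin n)) ^ r) := fun r =>
    hl.rpow_const fun y => Or.inl y.2.1.ne'
  refine (PiLp.continuous_toLp 2 _).comp (continuous_pi fun i => ?_)
  by_cases hi : (i : ℕ) + 1 = n
  · simpa [hi] using hr p
  · simp only [hi, if_false]
    exact Continuous.mul (by fun_prop) (hr q)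

/-- For every `a > 0`, `φ_a` is a homeomorphism of the model simplex `Ω_n`
onto the outward cuspidal domain `Ω_γ`, with inverse given by `ψ_a`. -/
theorem stmt_0 (n : ℕ) (hn : 2 ≤ n) (γ : ℝ) (hγ : (n : ℝ) < γ)
    (σ : ℝ) (hσ : σ = (γ - 1) / ((n : ℝ) - 1)) (a : ℝ) (ha : 0 < a) :
    ∃ h : (simplexDomain n) ≃ₜ (cuspDomain n σ),
      (∀ y : simplexDomain n, (h y : EuclideanSpace ℝ (Fin n)) = phiMap n σ a y) ∧
      (∀ x : cuspDomain n σ, (h.symm x : EuclideanSpace ℝ (Fin n)) = psiMap n σ a x) := by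
  have ha' : a ≠ 0 := ha.ne'
  have h1a : 0 < 1 / a := by positivity
  refine ⟨⟨⟨fun y => ⟨genMap n a (a * σ - 1) y, genMap_mem hn ha (by ring) y.2⟩,
    fun x => ⟨genMap n (1 / a) (1 / a - σ) x,
      genMap_mem (s' := 1) hn h1a (by ring) x.2⟩, ?_, ?_⟩, ?_, ?_⟩, fun y => rfl, fun x => rfl⟩
  · intro y
    exact Subtype.ext (genMap_inv hn (by field_simp) (by field_simp; ring) y.2)
  · intro x
    exact Subtype.ext (genMap_inv hn (by field_simp) (by field_simp; ring) x.2)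
  · exact (genMap_cont a (a * σ - 1) 1).subtype_mk _
  · exact (genMap_cont (1 / a) (1 / a - σ) σ).subtype_mk _
end
end

section
/- For every real a > 0 and every y ∈ Ω_n, the operator norm of the derivative of φ_a at y satisfies ‖Dφ_a(y)‖ ≤ y_n^{a−1} · √((n−1)(aσ−1)² + (n−1) + a²). -/
open MeasureTheory Real Filter Topology
open scoped ENNReal

noncomputable section

/-- For every `a > 0` and `y ∈ Ω_n`, the operator norm of `Dφ_a(y)` satisfies
`‖Dφ_a(y)‖ ≤ y_n^{a-1} · √((n-1)(aσ-1)² + (n-1) + a²)`. -/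
theorem stmt_2 (n : ℕ) (hn : 2 ≤ n) (γ : ℝ) (hγ : (n : ℝ) < γ)
    (σ : ℝ) (hσ : σ = (γ - 1) / ((n : ℝ) - 1)) (a : ℝ) (ha : 0 < a)
    (y : EuclideanSpace ℝ (Fin n)) (hy : y ∈ simplexDomain n) :
    ‖fderiv ℝ (phiMap n σ a) y‖ ≤
      lastCoord y ^ (a - 1) *
        Real.sqrt (((n : ℝ) - 1) * (a * σ - 1) ^ 2 + ((n : ℝ) - 1) + a ^ 2) := by
  obtain ⟨m, rfl⟩ : ∃ m, n = m + 1 := ⟨n - 1, by omega⟩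
  have hL : ∀ x : EuclideanSpace ℝ (Fin (m+1)), lastCoord x = x (Fin.last m) := by
    intro x
    simp [lastCoord, Fin.last]
  obtain ⟨h0, h1, hi⟩ := hy
  have hm : (1 : ℝ) ≤ m := by
    have : 1 ≤ m := by omega
    exact_mod_cast this
  have hσ1 : 1 ≤ σ := by
    push_cast at hσ hγ
    rw [hσ, le_div_iff₀ (by linarith)]
    linarith
  rw [hL] at h0 h1 ⊢
  simp only [hL, Real.rpow_one] at hi
  set t := y (Fin.last m) with ht
  set b := a * σ - 1 with hb
  have hcoord : ∀ i : Fin (m+1), HasFDerivAt (fun x : EuclideanSpace ℝ (Fin (m+1)) => x i)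
      (EuclideanSpace.proj i : EuclideanSpace ℝ (Fin (m+1)) →L[ℝ] ℝ) y := fun i =>
    (EuclideanSpace.proj i : EuclideanSpace ℝ (Fin (m+1)) →L[ℝ] ℝ).hasFDerivAt
  have hA : HasFDerivAt (fun x => phiMap (m+1) σ a x (Fin.last m))
      ((a * t ^ (a - 1)) • (EuclideanSpace.proj (Fin.last m) : EuclideanSpace ℝ (Fin (m+1)) →L[ℝ] ℝ)) y := by
    have := (hcoord (Fin.last m)).rpow_const (p := a) (Or.inl h0.ne')
    simpa [phiMap, hL] using this
  have hB : ∀ i : Fin m, HasFDerivAt (fun x => phiMap (m+1) σ a x i.castSucc)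
      (y i.castSucc • ((b * t ^ (b - 1)) • (EuclideanSpace.proj (Fin.last m) : EuclideanSpace ℝ (Fin (m+1)) →L[ℝ] ℝ))
        + (t ^ b) • (EuclideanSpace.proj i.castSucc : EuclideanSpace ℝ (Fin (m+1)) →L[ℝ] ℝ)) y := by
    intro i
    have := (hcoord i.castSucc).mul ((hcoord (Fin.last m)).rpow_const (p := b) (Or.inl h0.ne'))
    have hne : (i : ℕ) ≠ m := i.isLt.ne
    have he : (fun x => phiMap (m+1) σ a x i.castSucc) =
        fun x : EuclideanSpace ℝ (Fin (m+1)) => x i.castSucc * x (Fin.last m) ^ b := by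
      funext x
      simp [phiMap, hL, hne, hb]
    rw [he]
    exact this
  have hd : DifferentiableAt ℝ (phiMap (m+1) σ a) y := by
    rw [differentiableAt_euclidean]
    intro i
    refine Fin.lastCases ?_ ?_ i
    · exact hA.differentiableAt
    · intro i
      exact (hB i).differentiableAt
  have hD : ∀ i, HasFDerivAt (fun x => phiMap (m+1) σ a x i)
      ((EuclideanSpace.proj i : EuclideanSpace ℝ (Fin (m+1)) →L[ℝ] ℝ) ∘L
        fderiv ℝ (phiMap (m+1) σ a) y) y := fun i =>
    (EuclideanSpace.proj i : EuclideanSpace ℝ (Fin (m+1)) →L[ℝ] ℝ).hasFDerivAt.comp y hd.hasFDerivAt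
  have ht1 : 0 < t ^ (a - 1) := Real.rpow_pos_of_pos h0 _
  have htb : 0 < t ^ b := Real.rpow_pos_of_pos h0 _
  have hle : t ^ b ≤ t ^ (a - 1) :=
    Real.rpow_le_rpow_of_exponent_ge h0 h1.le (by rw [hb]; nlinarith)
  have hbt : t ^ (b - 1) * t = t ^ b := by
    rw [← Real.rpow_add_one h0.ne']; congr 1; ring
  refine ContinuousLinearMap.opNorm_le_bound _ (by positivity) fun v => ?_
  set w := fderiv ℝ (phiMap (m+1) σ a) y v with hw
  have hwl : w (Fin.last m) = a * t ^ (a - 1) * v (Fin.last m) := by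
    have := congrArg (fun L => L v) ((hD (Fin.last m)).unique hA)
    simpa using this
  have hwi : ∀ i : Fin m, w i.castSucc =
      y i.castSucc * (b * t ^ (b - 1) * v (Fin.last m)) + t ^ b * v i.castSucc := by
    intro i
    have := congrArg (fun L => L v) ((hD i.castSucc).unique (hB i))
    simpa using this
  have hnv : ‖v‖ ^ 2 = ∑ i : Fin m, v i.castSucc ^ 2 + v (Fin.last m) ^ 2 := by
    rw [EuclideanSpace.real_norm_sq_eq, Fin.sum_univ_castSucc]
  have hnw : ‖w‖ ^ 2 = ∑ i : Fin m, w i.castSucc ^ 2 + w (Fin.last m) ^ 2 := by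
    rw [EuclideanSpace.real_norm_sq_eq, Fin.sum_univ_castSucc]
  have hvl : v (Fin.last m) ^ 2 ≤ ‖v‖ ^ 2 := by
    rw [hnv]
    have : 0 ≤ ∑ i : Fin m, v i.castSucc ^ 2 := Finset.sum_nonneg fun _ _ => sq_nonneg _
    linarith
  have hvi : ∀ i : Fin m, v i.castSucc ^ 2 + v (Fin.last m) ^ 2 ≤ ‖v‖ ^ 2 := by
    intro i
    rw [hnv]
    have := Finset.single_le_sum (f := fun i : Fin m => v i.castSucc ^ 2)
      (fun _ _ => sq_nonneg _) (Finset.mem_univ i)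
    simp only at this
    linarith
  have hbd : ∀ i : Fin m, w i.castSucc ^ 2 ≤ (t ^ (a - 1)) ^ 2 * ((1 + b ^ 2) * ‖v‖ ^ 2) := by
    intro i
    obtain ⟨hy0, hy1⟩ := hi i.castSucc (by have := i.isLt; simp; omega)
    have hr : 0 ≤ y i.castSucc / t ∧ y i.castSucc / t ≤ 1 :=
      ⟨by positivity, (div_le_one h0).2 hy1.le⟩
    set r := y i.castSucc / t with hrdef
    have hyr : y i.castSucc = r * t := by rw [hrdef]; field_simp
    have e : w i.castSucc = t ^ b * (r * b * v (Fin.last m) + v i.castSucc) := by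
      rw [hwi, hyr, ← hbt]; ring
    rw [e, mul_pow]
    have hr2 : r ^ 2 ≤ 1 := by nlinarith [hr.1, hr.2]
    have k1 : (r * b * v (Fin.last m) + v i.castSucc) ^ 2 ≤
        (1 + (r * b) ^ 2) * (v i.castSucc ^ 2 + v (Fin.last m) ^ 2) := by
      nlinarith [sq_nonneg (r * b * v i.castSucc - v (Fin.last m))]
    have k2 : 1 + (r * b) ^ 2 ≤ 1 + b ^ 2 := by
      rw [mul_pow]; nlinarith [sq_nonneg b]
    refine mul_le_mul (pow_le_pow_left₀ htb.le hle 2) (k1.trans ?_) (sq_nonneg _) (sq_nonneg _)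
    exact mul_le_mul k2 (hvi i) (by positivity) (by positivity)
  have hsum := Finset.sum_le_sum (s := Finset.univ) fun (i : Fin m) _ => hbd i
  simp only [Finset.sum_const, Finset.card_univ, Fintype.card_fin, nsmul_eq_mul] at hsum
  have hS : 0 ≤ ((m + 1 : ℕ) - 1 : ℝ) * b ^ 2 + ((m + 1 : ℕ) - 1 : ℝ) + a ^ 2 := by
    push_cast
    simp only [add_sub_cancel_right]
    positivity
  refine (sq_le_sq₀ (norm_nonneg _) (by positivity)).1 ?_
  rw [mul_pow, mul_pow, Real.sq_sqrt hS, hnw, hwl]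
  push_cast
  have k3 : (a * t ^ (a - 1)) ^ 2 * v (Fin.last m) ^ 2 ≤ (a * t ^ (a - 1)) ^ 2 * ‖v‖ ^ 2 :=
    mul_le_mul_of_nonneg_left hvl (sq_nonneg _)
  rw [mul_pow (a * t ^ (a - 1))]
  refine (add_le_add hsum k3).trans (le_of_eq ?_)
  ring
end
end

section
/- Let 1 < p < n and let 0 < a ≤ (n−p)/(γ−p). Then for every y ∈ Ω_n the p-distortion of φ_a at y satisfies ‖Dφ_a(y)‖^p / det Dφ_a(y) ≤ (1/a) · ((n−1)(aσ−1)² + (n−1) + a²)^{p/2}; in particular the essential supremum of ‖Dφ_a‖^p / det Dφ_a over Ω_n is finite. -/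
open MeasureTheory Real Filter Topology
open scoped ENNReal

noncomputable section

lemma lastCoord_succ (m : ℕ) (x : EuclideanSpace ℝ (Fin (m + 1))) :
    lastCoord x = x (Fin.last m) := by
  simp [lastCoord, Fin.last]

/-- The Jacobian matrix of `phiMap` at a point `y` with last coordinate `t`. -/
def jacMat (m : ℕ) (b a : ℝ) (y : EuclideanSpace ℝ (Fin (m + 1))) :
    Matrix (Fin (m + 1)) (Fin (m + 1)) ℝ :=
  Matrix.of fun i j =>
    if i = Fin.last m then (if j = Fin.last m then a * y (Fin.last m) ^ (a - 1) else 0)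
    else (if j = i then y (Fin.last m) ^ b else 0) +
      (if j = Fin.last m then y i * (b * y (Fin.last m) ^ (b - 1)) else 0)

lemma jacMat_mulVec_last (m : ℕ) (b a : ℝ) (y v : EuclideanSpace ℝ (Fin (m + 1))) :
    Matrix.toEuclideanCLM (𝕜 := ℝ) (jacMat m b a y) v (Fin.last m) =
      a * y (Fin.last m) ^ (a - 1) * v (Fin.last m) := by
  simp [Matrix.ofLp_toEuclideanCLM, jacMat, Matrix.mulVec, dotProduct]

lemma jacMat_mulVec_ne (m : ℕ) (b a : ℝ) (y v : EuclideanSpace ℝ (Fin (m + 1)))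
    (i : Fin (m + 1)) (hi : i ≠ Fin.last m) :
    Matrix.toEuclideanCLM (𝕜 := ℝ) (jacMat m b a y) v i =
      y (Fin.last m) ^ b * v i + y i * (b * y (Fin.last m) ^ (b - 1)) * v (Fin.last m) := by
  simp [Matrix.ofLp_toEuclideanCLM, jacMat, Matrix.mulVec, dotProduct, hi, add_mul,
    Finset.sum_add_distrib]

lemma fderiv_phi (m : ℕ) (σ a : ℝ) (y : EuclideanSpace ℝ (Fin (m + 1)))
    (hy : 0 < y (Fin.last m)) :
    fderiv ℝ (phiMap (m + 1) σ a) y =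
      Matrix.toEuclideanCLM (𝕜 := ℝ) (jacMat m (a * σ - 1) a y) := by
  apply HasFDerivAt.fderiv
  rw [← hasFDerivWithinAt_univ, hasFDerivWithinAt_euclidean]
  intro i
  rw [hasFDerivWithinAt_univ]
  have hp : ∀ j : Fin (m + 1), HasFDerivAt (fun x : EuclideanSpace ℝ (Fin (m + 1)) => x j)
      (PiLp.proj 2 (fun _ : Fin (m + 1) => ℝ) j : EuclideanSpace ℝ (Fin (m + 1)) →L[ℝ] ℝ) y :=
    fun j => (PiLp.proj 2 (fun _ : Fin (m + 1) => ℝ) j :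
      EuclideanSpace ℝ (Fin (m + 1)) →L[ℝ] ℝ).hasFDerivAt
  have hr : ∀ c : ℝ, _ := fun c : ℝ =>
    (hp (Fin.last m)).rpow_const (p := c) (Or.inl hy.ne')
  by_cases hi : i = Fin.last m
  · subst hi
    have := hr a
    refine HasFDerivAt.congr_of_eventuallyEq (HasFDerivAt.congr_fderiv this ?_)
      (Eventually.of_forall fun x => ?_)
    · ext v
      refine Eq.symm ((jacMat_mulVec_last m (a * σ - 1) a y v).trans ?_)
      simp
    · simp [phiMap, lastCoord_succ]
  · have := (hp i).mul (hr (a * σ - 1))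
    have hi' : (i : ℕ) ≠ m := fun h => hi (Fin.ext h)
    refine HasFDerivAt.congr_of_eventuallyEq (HasFDerivAt.congr_fderiv this ?_)
      (Eventually.of_forall fun x => ?_)
    · ext v
      refine Eq.symm ((jacMat_mulVec_ne m (a * σ - 1) a y v i hi).trans ?_)
      simp
      ring
    · simp [phiMap, lastCoord_succ, hi']

lemma jacMat_det (m : ℕ) (b a : ℝ) (y : EuclideanSpace ℝ (Fin (m + 1))) :
    (Matrix.toEuclideanCLM (𝕜 := ℝ) (jacMat m b a y)).det =
      (y (Fin.last m) ^ b) ^ m * (a * y (Fin.last m) ^ (a - 1)) := by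
  rw [ContinuousLinearMap.det, Matrix.coe_toEuclideanCLM_eq_toEuclideanLin,
    Matrix.toEuclideanLin,
    Matrix.toLpLin_eq_toLin, LinearMap.det_toLin, Matrix.det_of_isUpperTriangular,
    Fin.prod_univ_castSucc]
  · simp [jacMat]
  · intro i j hij
    have hij' : j < i := hij
    have h1 : j ≠ Fin.last m := fun h => by
      subst h
      exact absurd (Fin.le_last i) (not_le.mpr hij')
    simp [jacMat, h1, hij'.ne]

lemma jacMat_norm (m : ℕ) (b a : ℝ) (y : EuclideanSpace ℝ (Fin (m + 1)))
    (ha : 0 < a) (hab : a - 1 ≤ b)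
    (hy : 0 < y (Fin.last m)) (hy1 : y (Fin.last m) < 1)
    (hyi : ∀ i : Fin m, 0 < y i.castSucc ∧ y i.castSucc < y (Fin.last m)) :
    ‖Matrix.toEuclideanCLM (𝕜 := ℝ) (jacMat m b a y)‖ ≤
      y (Fin.last m) ^ (a - 1) * √(m * b ^ 2 + m + a ^ 2) := by
  have hs : 0 < y (Fin.last m) ^ (a - 1) := rpow_pos_of_pos hy _
  refine ContinuousLinearMap.opNorm_le_bound _ (by positivity) fun v => ?_
  refine le_of_sq_le_sq ?_ (by positivity)
  rw [mul_pow, mul_pow, Real.sq_sqrt (by positivity), EuclideanSpace.real_norm_sq_eq,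
    EuclideanSpace.real_norm_sq_eq, Fin.sum_univ_castSucc, jacMat_mulVec_last]
  set s := y (Fin.last m) ^ (a - 1) with hsdef
  set N := ∑ i, v i ^ 2 with hN
  have hNl : v (Fin.last m) ^ 2 ≤ N :=
    Finset.single_le_sum (f := fun i => v i ^ 2) (fun i _ => sq_nonneg _) (Finset.mem_univ _)
  have key : ∀ i : Fin m,
      (Matrix.toEuclideanCLM (𝕜 := ℝ) (jacMat m b a y) v i.castSucc) ^ 2 ≤
        s ^ 2 * (b ^ 2 + 1) * N := by
    intro i
    rw [jacMat_mulVec_ne m b a y v _ (Fin.castSucc_lt_last i).ne]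
    have hNi : v i.castSucc ^ 2 + v (Fin.last m) ^ 2 ≤ N := by
      rw [hN, Fin.sum_univ_castSucc]
      have := Finset.single_le_sum (f := fun i : Fin m => v i.castSucc ^ 2)
        (fun i _ => sq_nonneg _) (Finset.mem_univ i)
      simpa using this
    set t := y (Fin.last m) with ht
    obtain ⟨h0, h1⟩ := hyi i
    have hb0 : 0 < t ^ b := rpow_pos_of_pos hy _
    have hbs : t ^ b ≤ s := rpow_le_rpow_of_exponent_ge hy hy1.le hab
    have hb1 : t ^ (b - 1) = t ^ b / t := by rw [rpow_sub_one hy.ne']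
    set r := y i.castSucc / t with hr
    have hr0 : 0 < r := by positivity
    have hr1 : r ≤ 1 := by rw [hr, div_le_one hy]; exact h1.le
    have e : t ^ b * v i.castSucc + y i.castSucc * (b * t ^ (b - 1)) * v (Fin.last m)
        = t ^ b * (v i.castSucc + r * b * v (Fin.last m)) := by
      rw [hb1, hr]; field_simp
    rw [e, mul_pow, mul_assoc (s ^ 2)]
    have hr2 : r ^ 2 ≤ 1 := pow_le_one₀ hr0.le hr1
    apply mul_le_mul (pow_le_pow_left₀ hb0.le hbs 2) _ (sq_nonneg _) (sq_nonneg _)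
    calc (v i.castSucc + r * b * v (Fin.last m)) ^ 2
        ≤ (r ^ 2 * b ^ 2 + 1) * (v i.castSucc ^ 2 + v (Fin.last m) ^ 2) := by
          nlinarith [sq_nonneg (r * b * v i.castSucc - v (Fin.last m))]
      _ ≤ (b ^ 2 + 1) * N := by
          apply mul_le_mul _ hNi (by positivity) (by positivity)
          nlinarith [sq_nonneg b]
  have hsum := Finset.sum_le_sum fun i (_ : i ∈ Finset.univ) => key i
  simp only [Finset.sum_const, Finset.card_univ, Fintype.card_fin, nsmul_eq_mul] at hsum
  have hlast : (a * s * v (Fin.last m)) ^ 2 ≤ s ^ 2 * a ^ 2 * N := by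
    have := mul_le_mul_of_nonneg_left hNl (by positivity : 0 ≤ s ^ 2 * a ^ 2)
    linarith
  linarith

lemma measurableSet_simplex (m : ℕ) : MeasurableSet (simplexDomain (m + 1)) := by
  have hj : ∀ j : Fin (m + 1), Measurable fun x : EuclideanSpace ℝ (Fin (m + 1)) => x j :=
    fun j => by fun_prop
  simp only [simplexDomain, cuspDomain, lastCoord_succ, rpow_one]
  simp only [Set.ofPred_and, Set.ofPred_forall]
  exact (measurableSet_lt measurable_const (hj _)).inter
    ((measurableSet_lt (hj _) measurable_const).inter
    (MeasurableSet.iInter fun i => MeasurableSet.iInter fun _ =>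
      (measurableSet_lt measurable_const (hj _)).inter (measurableSet_lt (hj _) (hj _))))

lemma pointwise_bound (m : ℕ) (hm : 1 ≤ m) (γ : ℝ) (hγ : (m : ℝ) + 1 < γ)
    (σ : ℝ) (hσ : σ = (γ - 1) / m)
    (p : ℝ) (hp : 1 < p) (hpn : p < (m : ℝ) + 1)
    (a : ℝ) (ha : 0 < a) (ha' : a ≤ ((m : ℝ) + 1 - p) / (γ - p))
    (y : EuclideanSpace ℝ (Fin (m + 1))) (hy : y ∈ simplexDomain (m + 1)) :
    ‖fderiv ℝ (phiMap (m + 1) σ a) y‖ ^ p / (fderiv ℝ (phiMap (m + 1) σ a) y).det ≤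
      (1 / a) * ((m : ℝ) * (a * σ - 1) ^ 2 + m + a ^ 2) ^ (p / 2) := by
  have hm0 : (0 : ℝ) < m := by exact_mod_cast hm
  simp only [simplexDomain, cuspDomain, lastCoord_succ, rpow_one, Set.mem_ofPred_eq] at hy
  obtain ⟨h0, h1, hi⟩ := hy
  have hσ1 : 1 ≤ σ := by rw [hσ, le_div_iff₀ hm0]; linarith
  have hms : m * σ = γ - 1 := by rw [hσ]; field_simp
  have hN := jacMat_norm m (a * σ - 1) a y ha (by nlinarith) h0 h1
    (fun i => hi _ (by simpa using i.isLt.ne))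
  rw [fderiv_phi m σ a y h0, jacMat_det]
  set t := y (Fin.last m) with ht
  set K := (m : ℝ) * (a * σ - 1) ^ 2 + m + a ^ 2 with hK
  have hK0 : 0 < K := by positivity
  have hdet : (t ^ (a * σ - 1)) ^ m * (a * t ^ (a - 1)) = a * t ^ (a * γ - (m + 1)) := by
    rw [← rpow_natCast, ← rpow_mul h0.le, mul_left_comm, ← rpow_add h0]
    congr 2
    linear_combination a * hms
  rw [hdet]
  have hpow : ‖Matrix.toEuclideanCLM (𝕜 := ℝ) (jacMat m (a * σ - 1) a y)‖ ^ p ≤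
      t ^ ((a - 1) * p) * K ^ (p / 2) := by
    refine (rpow_le_rpow (norm_nonneg _) hN (by linarith)).trans_eq ?_
    rw [mul_rpow (by positivity) (by positivity), ← rpow_mul h0.le, Real.sqrt_eq_rpow,
      ← rpow_mul hK0.le]
    congr 2
    ring
  have hexp : a * γ - (m + 1) ≤ (a - 1) * p := by
    rw [le_div_iff₀ (by linarith)] at ha'
    linarith
  have hle : t ^ ((a - 1) * p) ≤ t ^ (a * γ - (m + 1)) :=
    rpow_le_rpow_of_exponent_ge h0 h1.le hexp
  have hd : 0 < t ^ (a * γ - (m + 1)) := rpow_pos_of_pos h0 _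
  rw [div_le_iff₀ (by positivity)]
  calc _ ≤ _ := hpow
    _ ≤ t ^ (a * γ - (m + 1)) * K ^ (p / 2) :=
      mul_le_mul_of_nonneg_right hle (by positivity)
    _ = _ := by field_simp

/-- For `1 < p < n` and `0 < a ≤ (n-p)/(γ-p)`, the `p`-distortion of `φ_a`
satisfies the pointwise bound
`‖Dφ_a(y)‖^p / det Dφ_a(y) ≤ (1/a)((n-1)(aσ-1)² + (n-1) + a²)^{p/2}` on `Ω_n`;
in particular its essential supremum over `Ω_n` is finite. -/
theorem stmt_3 (n : ℕ) (hn : 2 ≤ n) (γ : ℝ) (hγ : (n : ℝ) < γ)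
    (σ : ℝ) (hσ : σ = (γ - 1) / ((n : ℝ) - 1))
    (p : ℝ) (hp : 1 < p) (hpn : p < (n : ℝ))
    (a : ℝ) (ha : 0 < a) (ha' : a ≤ ((n : ℝ) - p) / (γ - p)) :
    (∀ y ∈ simplexDomain n,
        ‖fderiv ℝ (phiMap n σ a) y‖ ^ p / (fderiv ℝ (phiMap n σ a) y).det ≤
          (1 / a) * (((n : ℝ) - 1) * (a * σ - 1) ^ 2 + ((n : ℝ) - 1) + a ^ 2) ^ (p / 2)) ∧
    ∃ C : ℝ, ∀ᵐ y ∂(volume.restrict (simplexDomain n)),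
        ‖fderiv ℝ (phiMap n σ a) y‖ ^ p / (fderiv ℝ (phiMap n σ a) y).det ≤ C := by
  obtain ⟨m, rfl⟩ : ∃ m, n = m + 1 := ⟨n - 1, by omega⟩
  have key : ∀ y ∈ simplexDomain (m + 1),
      ‖fderiv ℝ (phiMap (m + 1) σ a) y‖ ^ p / (fderiv ℝ (phiMap (m + 1) σ a) y).det ≤
        (1 / a) * ((((m + 1 : ℕ) : ℝ) - 1) * (a * σ - 1) ^ 2 + (((m + 1 : ℕ) : ℝ) - 1)
          + a ^ 2) ^ (p / 2) := by
    intro y hy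
    have hc : ((m + 1 : ℕ) : ℝ) = (m : ℝ) + 1 := by push_cast; ring
    rw [hc] at hγ hσ hpn ha' ⊢
    rw [add_sub_cancel_right] at hσ ⊢
    exact pointwise_bound m (by omega) γ hγ σ hσ p hp hpn a ha ha' y hy
  exact ⟨key, _, ae_restrict_of_forall_mem (measurableSet_simplex m) key⟩
end
end

section
/- For every u ∈ L^q(μ) (real-valued) there exists a unique t̃ ∈ ℝ such that ∫_X sgn(u(x) − t̃)·|u(x) − t̃|^{q−1} dμ(x) = 0. -/
open MeasureTheory Real Filter Topology

noncomputable section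

/-- `sgnPow q s = sgn(s)·|s|^{q-1}`: equal to `|s|^{q-1}` if `s > 0`, to `-|s|^{q-1}` if
`s < 0`, and to `0` if `s = 0`. -/
def sgnPow (q s : ℝ) : ℝ := Real.sign s * |s| ^ (q - 1)

theorem sgnPow_eq (q s : ℝ) (hq : 1 < q) :
    sgnPow q s = (max s 0) ^ (q - 1) - (max (-s) 0) ^ (q - 1) := by
  have h0 : (0 : ℝ) ^ (q - 1) = 0 := Real.zero_rpow (by linarith)
  unfold sgnPow
  rcases lt_trichotomy s 0 with h | h | h
  · rw [Real.sign_of_neg h, abs_of_neg h, max_eq_right h.le, max_eq_left (by linarith), h0]; ring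
  · subst h; simp
  · rw [Real.sign_of_pos h, abs_of_pos h, max_eq_left h.le, max_eq_right (by linarith), h0]; ring

theorem sgnPow_cont (q : ℝ) (hq : 1 < q) : Continuous (sgnPow q) := by
  have : sgnPow q = fun s => (max s 0) ^ (q - 1) - (max (-s) 0) ^ (q - 1) := by
    funext s; exact sgnPow_eq q s hq
  rw [this]
  have hc := Real.continuous_rpow_const (q := q - 1) (by linarith)
  exact (hc.comp (by fun_prop : Continuous fun s : ℝ => max s 0)).sub
    (hc.comp (by fun_prop : Continuous fun s : ℝ => max (-s) 0))

theorem sgnPow_strictMono (q : ℝ) (hq : 1 < q) : StrictMono (sgnPow q) := by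
  intro s t hst
  rw [sgnPow_eq q s hq, sgnPow_eq q t hq]
  have h1 : (max s 0) ^ (q - 1) ≤ (max t 0) ^ (q - 1) :=
    Real.rpow_le_rpow (le_max_right _ _) (max_le_max_right _ hst.le) (by linarith)
  have h2 : (max (-t) 0) ^ (q - 1) ≤ (max (-s) 0) ^ (q - 1) :=
    Real.rpow_le_rpow (le_max_right _ _) (max_le_max_right _ (by linarith)) (by linarith)
  by_cases ht : 0 < t
  · have h3 : (max s 0) ^ (q - 1) < (max t 0) ^ (q - 1) :=
      Real.rpow_lt_rpow (le_max_right _ _)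
        (by rw [max_eq_left ht.le]; exact max_lt hst ht) (by linarith)
    linarith
  · have hs : 0 < -s := by linarith
    have h3 : (max (-t) 0) ^ (q - 1) < (max (-s) 0) ^ (q - 1) :=
      Real.rpow_lt_rpow (le_max_right _ _)
        (by rw [max_eq_left hs.le]; exact max_lt (by linarith) hs) (by linarith)
    linarith

theorem sgnPow_neg (q s : ℝ) (hq : 1 < q) : sgnPow q (-s) = - sgnPow q s := by
  rw [sgnPow_eq q s hq, sgnPow_eq q (-s) hq, neg_neg]; ring

theorem sgnPow_abs_le (q s M : ℝ) (hq : 1 < q) (h : |s| ≤ M) : |sgnPow q s| ≤ sgnPow q M := by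
  have hm := (sgnPow_strictMono q hq).monotone
  rw [abs_le] at h ⊢
  refine ⟨?_, hm h.2⟩
  rw [← sgnPow_neg q M hq]
  exact hm h.1

theorem sgnPow_integrable {X : Type*} [MeasurableSpace X] (μ : Measure X) [IsFiniteMeasure μ]
    (q : ℝ) (hq : 1 < q) (u : X → ℝ) (hu : MemLp u (ENNReal.ofReal q) μ) :
    Integrable (fun x => sgnPow q (u x)) μ := by
  have hi : Integrable (fun x => ‖u x‖ ^ q) μ := by
    have := hu.integrable_norm_rpow (by simp; linarith) (by simp)
    rwa [ENNReal.toReal_ofReal (by linarith)] at this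
  refine Integrable.mono' ((integrable_const (1 : ℝ)).add hi)
    ((sgnPow_cont q hq).comp_aestronglyMeasurable hu.1) (Eventually.of_forall fun x => ?_)
  have h1 : ‖sgnPow q (u x)‖ ≤ |u x| ^ (q - 1) := by
    unfold sgnPow
    rw [Real.norm_eq_abs, abs_mul, abs_of_nonneg (Real.rpow_nonneg (abs_nonneg (u x)) _)]
    have : |Real.sign (u x)| ≤ 1 := by
      rcases Real.sign_apply_eq (u x) with h | h | h <;> rw [h] <;> norm_num
    exact mul_le_of_le_one_left (Real.rpow_nonneg (abs_nonneg _) _) this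
  refine h1.trans ?_
  simp only [Pi.add_apply, Real.norm_eq_abs]
  have h0 := Real.rpow_nonneg (abs_nonneg (u x)) q
  rcases le_total |u x| 1 with h | h
  · have := Real.rpow_le_one (abs_nonneg _) h (by linarith : 0 ≤ q - 1)
    linarith
  · have := Real.rpow_le_rpow_of_exponent_le h (by linarith : q - 1 ≤ q)
    linarith

theorem sgnPow_exists_pos {X : Type*} [MeasurableSpace X] (μ : Measure X) [IsFiniteMeasure μ]
    (hμ : 0 < μ Set.univ) (q : ℝ) (hq : 1 < q)
    (u : X → ℝ) (hu : MemLp u (ENNReal.ofReal q) μ) :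
    ∃ t : ℝ, 0 < ∫ x, sgnPow q (u x + t) ∂μ := by
  have hm := (sgnPow_strictMono q hq).monotone
  have hint : ∀ t : ℝ, Integrable (fun x => sgnPow q (u x + t)) μ := fun t =>
    sgnPow_integrable μ q hq (fun x => u x + t) (hu.add (memLp_const t))
  have h0 : Integrable (fun x => sgnPow q (u x)) μ := sgnPow_integrable μ q hq u hu
  have hone : sgnPow q 1 = 1 := by simp [sgnPow]
  have key : Tendsto (fun n : ℕ => ∫ x, min (sgnPow q (u x + n)) 1 ∂μ) atTop
      (𝓝 (∫ _x, (1 : ℝ) ∂μ)) := by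
    refine tendsto_integral_of_dominated_convergence (fun x => |sgnPow q (u x)| + 1)
      (fun n => ((hint n).inf (integrable_const 1)).1) (h0.abs.add (integrable_const 1)) ?_ ?_
    · intro n
      refine Eventually.of_forall fun x => ?_
      have h1 : sgnPow q (u x) ≤ sgnPow q (u x + n) :=
        hm (le_add_of_nonneg_right (Nat.cast_nonneg n))
      have h2 := neg_abs_le (sgnPow q (u x))
      have h3 := abs_nonneg (sgnPow q (u x))
      rw [Real.norm_eq_abs, abs_le]
      refine ⟨le_min (by linarith) (by linarith), (min_le_right _ _).trans (by linarith)⟩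
    · refine Eventually.of_forall fun x => ?_
      obtain ⟨N, hN⟩ := exists_nat_ge (1 - u x)
      refine tendsto_const_nhds.congr' ?_
      filter_upwards [eventually_ge_atTop N] with n hn
      have hn' : (N : ℝ) ≤ n := by exact_mod_cast hn
      have : sgnPow q 1 ≤ sgnPow q (u x + n) := hm (by linarith)
      rw [min_eq_right (by linarith)]
  have hpos : 0 < ∫ _x, (1 : ℝ) ∂μ := by
    rw [integral_const, smul_eq_mul, mul_one]
    exact ENNReal.toReal_pos hμ.ne' (measure_ne_top _ _)
  obtain ⟨n, hn⟩ := (key.eventually (lt_mem_nhds hpos)).exists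
  exact ⟨n, hn.trans_le (integral_mono ((hint n).inf (integrable_const 1)) (hint n)
    fun x => min_le_left _ _)⟩

/-- For every `u ∈ L^q(μ)` there exists a unique `t̃ ∈ ℝ` such that
`∫_X sgn(u - t̃)·|u - t̃|^{q-1} dμ = 0`. -/
theorem stmt_8 {X : Type*} [MeasurableSpace X] (μ : Measure X) [IsFiniteMeasure μ]
    (hμ : 0 < μ Set.univ) (q : ℝ) (hq : 1 < q)
    (u : X → ℝ) (hu : MemLp u (ENNReal.ofReal q) μ) :
    ∃! t : ℝ, ∫ x, sgnPow q (u x - t) ∂μ = 0 := by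
  have hint : ∀ t : ℝ, Integrable (fun x => sgnPow q (u x - t)) μ := fun t =>
    sgnPow_integrable μ q hq (fun x => u x - t) (hu.sub (memLp_const t))
  have hcont : Continuous fun t : ℝ => ∫ x, sgnPow q (u x - t) ∂μ := by
    rw [continuous_iff_continuousAt]
    intro t₀
    refine continuousAt_of_dominated (bound := fun x => sgnPow q (|u x| + (|t₀| + 1)))
      (Eventually.of_forall fun t => (hint t).1) ?_
      (sgnPow_integrable μ q hq (fun x => |u x| + (|t₀| + 1)) (hu.abs.add (memLp_const _))) ?_
    · filter_upwards [Metric.ball_mem_nhds t₀ one_pos] with t ht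
      refine Eventually.of_forall fun x => sgnPow_abs_le q _ _ hq ?_
      rw [Metric.mem_ball, Real.dist_eq] at ht
      have h1 := abs_sub (u x) t
      have h2 := abs_sub_abs_le_abs_sub t t₀
      linarith
    · exact Eventually.of_forall fun x =>
        ((sgnPow_cont q hq).comp (by fun_prop : Continuous fun t => u x - t)).continuousAt
  have hanti : StrictAnti fun t : ℝ => ∫ x, sgnPow q (u x - t) ∂μ := by
    intro s t hst
    have hlt : ∀ x, sgnPow q (u x - t) < sgnPow q (u x - s) := fun x =>
      sgnPow_strictMono q hq (by linarith)
    have : 0 < ∫ x, (sgnPow q (u x - s) - sgnPow q (u x - t)) ∂μ := by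
      rw [integral_pos_iff_support_of_nonneg (fun x => (sub_pos.2 (hlt x)).le)
        ((hint s).sub (hint t))]
      convert hμ
      exact Set.eq_univ_of_forall fun x => (sub_pos.2 (hlt x)).ne'
    rw [integral_sub (hint s) (hint t)] at this
    exact sub_pos.1 this
  obtain ⟨a, ha⟩ := sgnPow_exists_pos μ hμ q hq u hu
  obtain ⟨b, hb⟩ := sgnPow_exists_pos μ hμ q hq (fun x => - u x) hu.neg
  have ha' : 0 ≤ ∫ x, sgnPow q (u x - (-a)) ∂μ := by
    simp only [sub_neg_eq_add]; exact ha.le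
  have hb' : ∫ x, sgnPow q (u x - b) ∂μ ≤ 0 := by
    have : ∀ x, sgnPow q (-u x + b) = - sgnPow q (u x - b) := fun x => by
      rw [← sgnPow_neg q _ hq]; congr 1; ring
    simp only [this, integral_neg] at hb
    linarith
  obtain ⟨t, ht⟩ := mem_range_of_exists_le_of_exists_ge hcont ⟨b, hb'⟩ ⟨-a, ha'⟩
  exact ⟨t, ht, fun s hs => hanti.injective (by simpa using hs.trans ht.symm)⟩
end
end

section
/- Let u ∈ L^q(μ) and let t̃ ∈ ℝ satisfy ∫_X sgn(u − t̃)·|u − t̃|^{q−1} dμ = 0. Then ‖u − t̃‖_{L^q(μ)} = inf_{c ∈ ℝ} ‖u − c‖_{L^q(μ)}. -/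
open MeasureTheory Real Filter Topology

noncomputable section

theorem sgnPow_aux (q : ℝ) (hq : 1 < q) (a h : ℝ) :
    |a| ^ q + q * sgnPow q a * h ≤ |a + h| ^ q := by
  have hn : 0 ≤ |a + h| ^ q := by positivity
  rcases eq_or_ne a 0 with rfl | ha
  · have : (0:ℝ) ^ q = 0 := Real.zero_rpow (by linarith)
    simp [sgnPow, this]
    positivity
  have hpos : 0 < |a| := abs_pos.mpr ha
  have hsub : |a| ^ (q - 1) = |a| ^ q / |a| := by
    rw [Real.rpow_sub hpos, Real.rpow_one]
  have hsgn : Real.sign a = |a| / a := by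
    rcases lt_or_gt_of_ne ha with h1 | h1
    · rw [Real.sign_of_neg h1, abs_of_neg h1]; field_simp
    · rw [Real.sign_of_pos h1, abs_of_pos h1]; field_simp
  have hL : |a| ^ q + q * sgnPow q a * h = |a| ^ q * (1 + q * (h / a)) := by
    rw [sgnPow, hsub, hsgn]; field_simp
  have hR : |a + h| ^ q = |a| ^ q * |1 + h / a| ^ q := by
    rw [← Real.mul_rpow (abs_nonneg _) (abs_nonneg _), ← abs_mul]
    congr 2; field_simp
  rw [hL, hR]
  apply mul_le_mul_of_nonneg_left _ (by positivity)
  rcases le_or_gt (-1) (h / a) with h1 | h1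
  · rw [abs_of_nonneg (by linarith)]
    exact one_add_mul_self_le_rpow_one_add h1 hq.le
  · have : 0 ≤ |1 + h / a| ^ q := by positivity
    nlinarith

theorem sgnPow_meas (q : ℝ) : Measurable (sgnPow q) := by
  have h : Measurable Real.sign := by
    unfold Real.sign
    exact Measurable.ite measurableSet_Iio measurable_const
      (Measurable.ite measurableSet_Ioi measurable_const measurable_const)
  unfold sgnPow
  exact h.mul (by fun_prop)

theorem sgnPow_bound (q : ℝ) (hq : 1 < q) (a : ℝ) : |sgnPow q a| ≤ 1 + |a| ^ q := by
  have h0 : |sgnPow q a| ≤ |a| ^ (q - 1) := by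
    rw [sgnPow, abs_mul, abs_of_nonneg (by positivity : 0 ≤ |a| ^ (q - 1))]
    apply mul_le_of_le_one_left (by positivity)
    rcases Real.sign_apply_eq a with h | h | h <;> simp [h]
  refine h0.trans ?_
  rcases le_total |a| 1 with h | h
  · have := Real.rpow_le_one (abs_nonneg a) h (by linarith : 0 ≤ q - 1)
    have : 0 ≤ |a| ^ q := by positivity
    linarith
  · have := Real.rpow_le_rpow_of_exponent_le h (by linarith : q - 1 ≤ q)
    linarith

/-- If `u ∈ L^q(μ)` and `t̃ ∈ ℝ` satisfies `∫_X sgn(u - t̃)·|u - t̃|^{q-1} dμ = 0`,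
then `‖u - t̃‖_{L^q(μ)} = inf_{c ∈ ℝ} ‖u - c‖_{L^q(μ)}`. -/
theorem stmt_9 {X : Type*} [MeasurableSpace X] (μ : Measure X) [IsFiniteMeasure μ]
    (hμ : 0 < μ Set.univ) (q : ℝ) (hq : 1 < q)
    (u : X → ℝ) (hu : MemLp u (ENNReal.ofReal q) μ) (t : ℝ)
    (ht : ∫ x, sgnPow q (u x - t) ∂μ = 0) :
    (∫ x, |u x - t| ^ q ∂μ) ^ (1 / q) = ⨅ c : ℝ, (∫ x, |u x - c| ^ q ∂μ) ^ (1 / q) := by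
  have hint : ∀ c : ℝ, Integrable (fun x => |u x - c| ^ q) μ := by
    intro c
    have h1 : MemLp (fun x => u x - c) (ENNReal.ofReal q) μ := hu.sub (memLp_const c)
    have h2 := h1.integrable_norm_rpow (by simp; linarith) (by simp)
    simpa [ENNReal.toReal_ofReal (by linarith : 0 ≤ q)] using h2
  have hs : Integrable (fun x => sgnPow q (u x - t)) μ := by
    refine ((integrable_const (1:ℝ)).add (hint t)).mono' ?_ ?_
    · have h3 : AEMeasurable (fun x => u x - t) μ := hu.aestronglyMeasurable.aemeasurable.sub_const t
      exact ((sgnPow_meas q).comp_aemeasurable h3).aestronglyMeasurable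
    · exact Eventually.of_forall fun x => sgnPow_bound q hq _
  have key : ∀ c : ℝ, (∫ x, |u x - t| ^ q ∂μ) ≤ ∫ x, |u x - c| ^ q ∂μ := by
    intro c
    have h4 : ∫ x, (|u x - t| ^ q + q * sgnPow q (u x - t) * (t - c)) ∂μ
        ≤ ∫ x, |u x - c| ^ q ∂μ := by
      refine integral_mono ((hint t).add ((hs.const_mul q).mul_const _)) (hint c) ?_
      intro x
      have := sgnPow_aux q hq (u x - t) (t - c)
      simpa using this
    rw [integral_add (hint t) ((hs.const_mul q).mul_const _), integral_mul_const,
      integral_const_mul, ht] at h4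
    simpa using h4
  have hnn : ∀ c : ℝ, 0 ≤ ∫ x, |u x - c| ^ q ∂μ := fun c =>
    integral_nonneg fun x => by positivity
  apply le_antisymm
  · exact le_ciInf fun c => Real.rpow_le_rpow (hnn t) (key c) (by positivity)
  · refine ciInf_le (f := fun c : ℝ => (∫ x, |u x - c| ^ q ∂μ) ^ (1 / q)) ⟨0, ?_⟩ t
    rintro _ ⟨c, rfl⟩
    exact Real.rpow_nonneg (hnn c) _
end
end

section
/- Let u ∈ L^q(μ) and define, for t ∈ ℝ, f(t) = ∫_X ((u(x) − t)^+)^{q−1} dμ(x) and g(t) = ∫_X ((u(x) − t)^−)^{q−1} dμ(x), where s^+ = max(s,0) and s^− = max(−s,0). Then f and g are real-valued and continuous on ℝ, f is nonincreasing, g is nondecreasing, f − g is strictly decreasing, and (f − g)(t) → +∞ as t → −∞ while (f − g)(t) → −∞ as t → +∞. -/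
open MeasureTheory Real Filter Topology

noncomputable section

lemma aux_int {X : Type*} [MeasurableSpace X] (μ : Measure X) [IsFiniteMeasure μ]
    (q : ℝ) (hq : 1 < q) (u : X → ℝ) (hu : MemLp u (ENNReal.ofReal q) μ) (t : ℝ) :
    Integrable (fun x => (max (u x - t) 0) ^ (q - 1)) μ := by
  have h1 : MemLp (fun x => u x - t) (ENNReal.ofReal q) μ := hu.sub (memLp_const t)
  have h2 : MemLp (fun x => u x - t) (ENNReal.ofReal (q - 1)) μ :=
    h1.mono_exponent (ENNReal.ofReal_le_ofReal (by linarith))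
  have h3 := h2.integrable_norm_rpow (by simpa using hq) ENNReal.ofReal_ne_top
  rw [ENNReal.toReal_ofReal (by linarith)] at h3
  have hc : Continuous (fun y : ℝ => (max y 0) ^ (q - 1)) :=
    (continuous_id.max continuous_const).rpow_const (fun _ => Or.inr (by linarith))
  refine h3.mono (hc.comp_aestronglyMeasurable h1.1) (Eventually.of_forall fun x => ?_)
  rw [Real.norm_of_nonneg (by positivity), Real.norm_of_nonneg (by positivity)]
  exact Real.rpow_le_rpow (by positivity) (max_le (le_abs_self _) (abs_nonneg _)) (by linarith)

lemma aux_pt (q : ℝ) (hq : 1 < q) {a b : ℝ} (h : a ≤ b) :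
    (max a 0) ^ (q - 1) ≤ (max b 0) ^ (q - 1) :=
  Real.rpow_le_rpow (le_max_right _ _) (max_le_max h le_rfl) (by linarith)

lemma aux_anti {X : Type*} [MeasurableSpace X] (μ : Measure X) [IsFiniteMeasure μ]
    (q : ℝ) (hq : 1 < q) (u : X → ℝ) (hu : MemLp u (ENNReal.ofReal q) μ) :
    Antitone (fun t => ∫ x, (max (u x - t) 0) ^ (q - 1) ∂μ) := by
  intro s t hst
  exact integral_mono (aux_int μ q hq u hu t) (aux_int μ q hq u hu s)
    (fun x => aux_pt q hq (by linarith))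

lemma aux_cont {X : Type*} [MeasurableSpace X] (μ : Measure X) [IsFiniteMeasure μ]
    (q : ℝ) (hq : 1 < q) (u : X → ℝ) (hu : MemLp u (ENNReal.ofReal q) μ) :
    Continuous (fun t => ∫ x, (max (u x - t) 0) ^ (q - 1) ∂μ) := by
  rw [continuous_iff_continuousAt]
  intro t
  refine continuousAt_of_dominated (bound := fun x => (max (u x - (t - 1)) 0) ^ (q - 1))
    (Eventually.of_forall fun s => (aux_int μ q hq u hu s).1) ?_ (aux_int μ q hq u hu _) ?_
  · filter_upwards [lt_mem_nhds (show t - 1 < t by linarith)] with s hs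
    refine Eventually.of_forall fun x => ?_
    rw [Real.norm_of_nonneg (by positivity)]
    exact aux_pt q hq (by linarith)
  · refine Eventually.of_forall fun x => Continuous.continuousAt ?_
    exact ((continuous_const.sub continuous_id).max continuous_const).rpow_const
      (fun _ => Or.inr (by linarith))

lemma aux_tend {X : Type*} [MeasurableSpace X] (μ : Measure X) [IsFiniteMeasure μ]
    (hμ : 0 < μ Set.univ) (q : ℝ) (hq : 1 < q) (u : X → ℝ) (hu : MemLp u (ENNReal.ofReal q) μ) :
    Tendsto (fun t => ∫ x, (max (u x - t) 0) ^ (q - 1) ∂μ) atBot atTop := by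
  obtain ⟨n, hn⟩ : ∃ n : ℕ, μ {x | -(n : ℝ) ≤ u x} ≠ 0 := by
    by_contra! h
    have h1 := measure_iUnion_null h
    have h2 : (⋃ n : ℕ, {x | -(n : ℝ) ≤ u x}) = Set.univ := by
      refine Set.eq_univ_of_forall fun x => Set.mem_iUnion.2 ?_
      obtain ⟨n, hn⟩ := exists_nat_ge (-u x)
      exact ⟨n, by simp only [Set.mem_ofPred_eq]; linarith⟩
    rw [h2] at h1
    exact hμ.ne' h1
  have hpos : 0 < μ.real {x | -(n : ℝ) ≤ u x} :=
    ENNReal.toReal_pos hn (measure_ne_top _ _)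
  have h1 : Tendsto (fun t : ℝ => (-(n : ℝ) - t)) atBot atTop :=
    tendsto_atTop_add_const_left _ _ tendsto_neg_atBot_atTop
  have h2 := ((tendsto_rpow_atTop (show 0 < q - 1 by linarith)).comp h1).atTop_mul_const hpos
  refine tendsto_atTop_mono' _ ?_ h2
  filter_upwards [eventually_le_atBot (-(n : ℝ))] with t ht
  refine le_trans ?_ (mul_meas_ge_le_integral_of_nonneg
    (Eventually.of_forall fun x => by positivity) (aux_int μ q hq u hu t)
    ((-(n : ℝ) - t) ^ (q - 1)))
  refine mul_le_mul_of_nonneg_left (measureReal_mono ?_) (Real.rpow_nonneg (by linarith) _)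
  intro x hx
  simp only [Set.mem_ofPred_eq] at hx ⊢
  exact Real.rpow_le_rpow (by linarith) (le_max_of_le_left (by linarith)) (by linarith)

/-- For `u ∈ L^q(μ)` define `f(t) = ∫_X ((u-t)⁺)^{q-1} dμ` and
`g(t) = ∫_X ((u-t)⁻)^{q-1} dμ`. Then `f` and `g` are real-valued (the integrands are
integrable) and continuous, `f` is nonincreasing, `g` is nondecreasing, `f - g` is strictly
decreasing, and `(f-g)(t) → +∞` as `t → -∞` while `(f-g)(t) → -∞` as `t → +∞`. -/
theorem stmt_10 {X : Type*} [MeasurableSpace X] (μ : Measure X) [IsFiniteMeasure μ]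
    (hμ : 0 < μ Set.univ) (q : ℝ) (hq : 1 < q)
    (u : X → ℝ) (hu : MemLp u (ENNReal.ofReal q) μ)
    (f g : ℝ → ℝ)
    (hf : f = fun t => ∫ x, (max (u x - t) 0) ^ (q - 1) ∂μ)
    (hg : g = fun t => ∫ x, (max (-(u x - t)) 0) ^ (q - 1) ∂μ) :
    (∀ t : ℝ, Integrable (fun x => (max (u x - t) 0) ^ (q - 1)) μ) ∧
    (∀ t : ℝ, Integrable (fun x => (max (-(u x - t)) 0) ^ (q - 1)) μ) ∧
    Continuous f ∧ Continuous g ∧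
    Antitone f ∧ Monotone g ∧
    StrictAnti (fun t => f t - g t) ∧
    Tendsto (fun t => f t - g t) atBot atTop ∧
    Tendsto (fun t => f t - g t) atTop atBot := by
  have hu' : MemLp (fun x => -u x) (ENNReal.ofReal q) μ := hu.neg
  have key : ∀ t x, -(u x - t) = -u x - -t := fun t x => by ring
  have hg' : g = fun t => (fun t => ∫ x, (max (-u x - t) 0) ^ (q - 1) ∂μ) (-t) := by
    rw [hg]; funext t; simp only [key]
  have If := aux_int μ q hq u hu
  have Ig : ∀ t : ℝ, Integrable (fun x => (max (-(u x - t)) 0) ^ (q - 1)) μ := fun t => by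
    simp only [key]; exact aux_int μ q hq _ hu' (-t)
  have Af : Antitone f := hf ▸ aux_anti μ q hq u hu
  have Mg : Monotone g := by
    rw [hg']; intro s t hst
    exact aux_anti μ q hq _ hu' (neg_le_neg hst)
  have Tf : Tendsto f atBot atTop := hf ▸ aux_tend μ hμ q hq u hu
  have Tg : Tendsto g atTop atTop := by
    rw [hg']; exact (aux_tend μ hμ q hq _ hu').comp tendsto_neg_atTop_atBot
  refine ⟨If, Ig, hf ▸ aux_cont μ q hq u hu, ?_, Af, Mg, ?_, ?_, ?_⟩
  · rw [hg']; exact (aux_cont μ q hq _ hu').comp continuous_neg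
  · intro s t hst
    have hp : ∀ x, 0 < ((max (u x - s) 0) ^ (q - 1) - (max (-(u x - s)) 0) ^ (q - 1))
        - ((max (u x - t) 0) ^ (q - 1) - (max (-(u x - t)) 0) ^ (q - 1)) := by
      intro x
      have a1 := aux_pt q hq (show u x - t ≤ u x - s by linarith)
      have a2 := aux_pt q hq (show -(u x - s) ≤ -(u x - t) by linarith)
      rcases lt_or_ge s (u x) with h | h
      · have : (max (u x - t) 0) ^ (q - 1) < (max (u x - s) 0) ^ (q - 1) :=
          Real.rpow_lt_rpow (le_max_right _ _)
            (lt_max_of_lt_left (max_lt (by linarith) (by linarith))) (by linarith)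
        linarith
      · have : (max (-(u x - s)) 0) ^ (q - 1) < (max (-(u x - t)) 0) ^ (q - 1) :=
          Real.rpow_lt_rpow (le_max_right _ _)
            (lt_max_of_lt_left (max_lt (by linarith) (by linarith))) (by linarith)
        linarith
    have Id : ∀ r : ℝ, Integrable (fun x => (max (u x - r) 0) ^ (q - 1)
        - (max (-(u x - r)) 0) ^ (q - 1)) μ := fun r => (If r).sub (Ig r)
    have h0 := (integral_pos_iff_support_of_nonneg (μ := μ) (fun x => (hp x).le)
      ((Id s).sub (Id t))).2 (by
        rw [Function.support_eq_univ fun x => (hp x).ne']; exact hμ)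
    rw [integral_sub (Id s) (Id t), integral_sub (If s) (Ig s),
      integral_sub (If t) (Ig t)] at h0
    simp only [hf, hg]
    linarith
  · refine tendsto_atTop_mono' _ ?_ (tendsto_atTop_add_const_right _ (-g 0) Tf)
    filter_upwards [eventually_le_atBot (0 : ℝ)] with t ht
    have := Mg ht
    linarith
  · refine tendsto_atBot_mono' _ ?_
      (tendsto_atBot_add_const_left _ (f 0) (tendsto_neg_atTop_atBot.comp Tg))
    filter_upwards [eventually_ge_atTop (0 : ℝ)] with t ht
    have := Af ht
    simp only [Function.comp]
    linarith
end
end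

section
/- Let v ∈ L^q(μ). Then the function h(t) = ∫_X |v(x) − t|^q dμ(x) is differentiable on ℝ with derivative h′(t) = −q ∫_X sgn(v(x) − t)·|v(x) − t|^{q−1} dμ(x). -/
open MeasureTheory Real Filter Topology

noncomputable section

lemma sgnPow_eq_aux (q s : ℝ) (hq : 1 < q) : |s| ^ (q - 2) * s = sgnPow q s := by
  unfold sgnPow
  rcases lt_trichotomy s 0 with h | h | h
  · rw [Real.sign_of_neg h, abs_of_neg h, show q - 1 = (q - 2) + 1 by ring,
      Real.rpow_add_one (by linarith)]
    ring
  · subst h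
    simp
  · rw [Real.sign_of_pos h, abs_of_pos h, show q - 1 = (q - 2) + 1 by ring,
      Real.rpow_add_one (by linarith)]
    ring

lemma abs_sgnPow_le_aux (q s : ℝ) : |sgnPow q s| ≤ |s| ^ (q - 1) := by
  unfold sgnPow
  have h0 : 0 ≤ |s| ^ (q - 1) := Real.rpow_nonneg (abs_nonneg s) _
  rw [abs_mul, abs_of_nonneg h0]
  rcases Real.sign_apply_eq s with h | h | h <;> rw [h] <;> simp [h0]

/-- For `v ∈ L^q(μ)`, the function `h(t) = ∫_X |v - t|^q dμ` is differentiable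
on `ℝ` with derivative `h'(t) = -q ∫_X sgn(v - t)·|v - t|^{q-1} dμ`. -/
theorem stmt_11 {X : Type*} [MeasurableSpace X] (μ : Measure X) [IsFiniteMeasure μ]
    (hμ : 0 < μ Set.univ) (q : ℝ) (hq : 1 < q)
    (v : X → ℝ) (hv : MemLp v (ENNReal.ofReal q) μ) (t : ℝ) :
    HasDerivAt (fun s => ∫ x, |v x - s| ^ q ∂μ)
      (-q * ∫ x, sgnPow q (v x - t) ∂μ) t := by
  have hq0 : 0 < q := by linarith
  have hint : ∀ w : X → ℝ, MemLp w (ENNReal.ofReal q) μ →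
      Integrable (fun x => |w x| ^ q) μ := by
    intro w hw
    have := hw.integrable_norm_rpow'
    simpa [ENNReal.toReal_ofReal hq0.le] using this
  have hsub : ∀ s : ℝ, MemLp (fun x => v x - s) (ENNReal.ofReal q) μ :=
    fun s => hv.sub (memLp_const s)
  have hb : Integrable (fun x => q * |(|v x| + (|t| + 1))| ^ q) μ :=
    (hint (fun x => |v x| + (|t| + 1)) (hv.abs.add (memLp_const _))).const_mul q
  have hd : ∀ x s, HasDerivAt (fun s => |v x - s| ^ q) (-q * sgnPow q (v x - s)) s := by
    intro x s
    have h1 := hasDerivAt_abs_rpow (v x - s) hq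
    have h2 : HasDerivAt (fun s => v x - s) (-1) s := by
      simpa using (hasDerivAt_id s).const_sub (v x)
    have h3 := h1.comp s h2
    have h4 : q * |v x - s| ^ (q - 2) * (v x - s) * -1 = -q * sgnPow q (v x - s) := by
      rw [← sgnPow_eq_aux q _ hq]
      ring
    rw [h4] at h3
    exact h3
  have key := hasDerivAt_integral_of_dominated_loc_of_deriv_le (μ := μ)
    (F := fun s x => |v x - s| ^ q) (F' := fun s x => -q * sgnPow q (v x - s))
    (bound := fun x => q * |(|v x| + (|t| + 1))| ^ q)
    (Metric.ball_mem_nhds t one_pos)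
    (Eventually.of_forall fun s => (hint _ (hsub s)).aestronglyMeasurable)
    (hint _ (hsub t)) ?_ ?_ hb
    (Eventually.of_forall fun x s _ => hd x s)
  · have := key.2
    rwa [integral_const_mul] at this
  · have hm : AEMeasurable (fun x => v x - t) μ := (hsub t).aestronglyMeasurable.aemeasurable
    have : AEMeasurable (fun x => -q * (|v x - t| ^ (q - 2) * (v x - t))) μ := by
      have h1 : AEMeasurable (fun x => |v x - t|) μ := by
        simpa [Real.norm_eq_abs] using hm.norm
      exact ((h1.pow_const (q - 2)).mul hm).const_mul (-q)
    simp only [sgnPow_eq_aux q _ hq] at this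
    exact this.aestronglyMeasurable
  · refine Eventually.of_forall fun x s hs => ?_
    rw [Metric.mem_ball, Real.dist_eq] at hs
    have hnn : 1 ≤ |v x| + (|t| + 1) := by
      linarith [abs_nonneg (v x), abs_nonneg t]
    have hle : |v x - s| ≤ |v x| + (|t| + 1) := by
      have h1 := abs_sub (v x) s
      have h2 := abs_sub_abs_le_abs_sub s t
      linarith
    rw [Real.norm_eq_abs, abs_mul, abs_neg, abs_of_pos hq0,
      abs_of_nonneg (zero_le_one.trans hnn)]
    refine mul_le_mul_of_nonneg_left ?_ hq0.le
    calc |sgnPow q (v x - s)| ≤ |v x - s| ^ (q - 1) := abs_sgnPow_le_aux _ _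
      _ ≤ (|v x| + (|t| + 1)) ^ (q - 1) :=
        Real.rpow_le_rpow (abs_nonneg _) hle (by linarith)
      _ ≤ (|v x| + (|t| + 1)) ^ q := Real.rpow_le_rpow_of_exponent_le hnn (by linarith)
end
end
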